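/- Let (Z, 𝒜) be a measurable space, n a positive integer, M > 0, F a countable nonempty set of measurable functions f : Z → [0, M], and let G = { z ↦ f(z) − λ : f ∈ F, λ ∈ [0, M] }. Then for every fixed sample z^n = (z₁,...,zₙ) ∈ Z^n, the Rademacher averages satisfy Rad_n(G(z^n)) ≤ Rad_n(F(z^n)) + M/√n. -/

import Mathlib

open Finset

/-- The Rademacher average of a function class `H` on a sample `z`:
`2^{-n}·Σ_{ε ∈ {−1,1}ⁿ} sup_{h∈H} (1/n)·Σᵢ εᵢ h(zᵢ)`. -/
noncomputable def rad {Z : Type*} {n : ℕ} (H : Set (Z → ℝ)) (z : Fin n → Z) : ℝ :=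
  (2 ^ n : ℝ)⁻¹ * ∑ ε : Fin n → Bool,
    ⨆ h : H, (n : ℝ)⁻¹ * ∑ i : Fin n, (if ε i then (1 : ℝ) else -1) * (h : Z → ℝ) (z i)

/-- The second moment of a sum of `n` independent random signs is `n`. -/
theorem sum_sq_sum_sign (n : ℕ) :
    ∑ ε : Fin n → Bool, (∑ i, (if ε i then (1 : ℝ) else -1)) ^ 2 = 2 ^ n * n := by
  induction n with
  | zero => simp
  | succ n ih =>
    rw [← (Fin.consEquiv fun _ => Bool).sum_comp, Fintype.sum_prod_type_right]
    simp only [Fin.consEquiv_apply, Fin.sum_univ_succ, Fin.cons_zero, Fin.cons_succ,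
      Fintype.sum_bool, if_true, Bool.false_eq_true, if_false]
    calc
      _ = ∑ ε : Fin n → Bool, (2 + 2 * (∑ i, (if ε i then (1 : ℝ) else -1)) ^ 2) :=
        Finset.sum_congr rfl fun ε _ => by ring
      _ = _ := by
        rw [Finset.sum_add_distrib, ← Finset.mul_sum, ih]
        simp
        ring

/-- The first absolute moment of a sum of `n` independent random signs is at most `√n`. -/
theorem sum_abs_sum_sign_le (n : ℕ) :
    ∑ ε : Fin n → Bool, |∑ i, (if ε i then (1 : ℝ) else -1)| ≤ 2 ^ n * Real.sqrt n := by
  refine abs_le_of_sq_le_sq' ?_ (by positivity) |>.2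
  refine sq_sum_le_card_mul_sum_sq.trans_eq ?_
  simp only [sq_abs]
  rw [sum_sq_sum_sign, mul_pow, Real.sq_sqrt n.cast_nonneg]
  simp
  ring

/-- The signed empirical means over a uniformly bounded class are bounded above. -/
theorem bddAbove_signed_mean {Z : Type*} {n : ℕ} {M : ℝ} {F : Set (Z → ℝ)}
    (hF : ∀ f ∈ F, ∀ z, |f z| ≤ M) (z : Fin n → Z) (ε : Fin n → Bool) :
    BddAbove (Set.range fun f : F =>
      (n : ℝ)⁻¹ * ∑ i, (if ε i then (1 : ℝ) else -1) * (f : Z → ℝ) (z i)) := by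
  refine ⟨(n : ℝ)⁻¹ * ∑ _i : Fin n, M, ?_⟩
  rintro _ ⟨f, rfl⟩
  refine mul_le_mul_of_nonneg_left (Finset.sum_le_sum fun i _ => ?_) (by positivity)
  have := abs_le.1 (hF f f.2 (z i))
  split_ifs <;> linarith

/-- the Rademacher average of the shifted class
`G = {z ↦ f(z) − λ : f ∈ F, λ ∈ [0,M]}` satisfies `Rad_n(G(zⁿ)) ≤ Rad_n(F(zⁿ)) + M/√n`. -/
theorem rad_shifted_class {Z : Type*} [MeasurableSpace Z] (n : ℕ) (hn : 0 < n)
    (M : ℝ) (hM : 0 < M)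
    (F : Set (Z → ℝ)) (hFc : F.Countable) (hFne : F.Nonempty)
    (hFmeas : ∀ f ∈ F, Measurable f) (hFbd : ∀ f ∈ F, ∀ z, f z ∈ Set.Icc 0 M)
    (G : Set (Z → ℝ))
    (hG : G = {g | ∃ f ∈ F, ∃ lam ∈ Set.Icc (0 : ℝ) M, g = fun z => f z - lam})
    (z : Fin n → Z) :
    rad G z ≤ rad F z + M / Real.sqrt n := by
  subst hG
  have hsup (ε : Fin n → Bool) :
      (⨆ h : {g | ∃ f ∈ F, ∃ lam ∈ Set.Icc (0 : ℝ) M, g = fun z => f z - lam},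
        (n : ℝ)⁻¹ * ∑ i, (if ε i then (1 : ℝ) else -1) * (h : Z → ℝ) (z i)) ≤
      (⨆ f : F, (n : ℝ)⁻¹ * ∑ i, (if ε i then (1 : ℝ) else -1) * (f : Z → ℝ) (z i)) +
        (n : ℝ)⁻¹ * M * |∑ i, (if ε i then (1 : ℝ) else -1)| := by
    obtain ⟨f₀, hf₀⟩ := hFne
    have : Nonempty {g | ∃ f ∈ F, ∃ lam ∈ Set.Icc (0 : ℝ) M, g = fun z => f z - lam} :=
      ⟨⟨_, f₀, hf₀, 0, ⟨le_rfl, hM.le⟩, rfl⟩⟩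
    refine ciSup_le ?_
    rintro ⟨_, f, hf, lam, hlam, rfl⟩
    have hle := le_ciSup (bddAbove_signed_mean (M := M) (fun f hf z =>
      abs_le.2 ⟨by linarith [(hFbd f hf z).1], (hFbd f hf z).2⟩) z ε) ⟨f, hf⟩
    have hshift : -lam * ∑ i, (if ε i then (1 : ℝ) else -1) ≤
        M * |∑ i, (if ε i then (1 : ℝ) else -1)| := by
      refine (le_abs_self _).trans ?_
      rw [abs_mul, abs_neg, abs_of_nonneg hlam.1]
      gcongr
      exact hlam.2
    have hscaled := mul_le_mul_of_nonneg_left hshift (inv_nonneg.2 (n.cast_nonneg (α := ℝ)))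
    simp only [mul_sub, Finset.sum_sub_distrib, ← Finset.sum_mul] at hle ⊢
    linarith
  have hsqrt : (n : ℝ)⁻¹ * Real.sqrt n = (Real.sqrt n)⁻¹ := by
    have hn' : (0 : ℝ) < n := Nat.cast_pos.2 hn
    have hs := Real.sqrt_pos.2 hn'
    field_simp
    exact Real.sq_sqrt hn'.le
  unfold rad
  calc
    _ ≤ (2 ^ n : ℝ)⁻¹ * ∑ ε : Fin n → Bool,
        ((⨆ f : F, (n : ℝ)⁻¹ * ∑ i, (if ε i then (1 : ℝ) else -1) * (f : Z → ℝ) (z i)) +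
          (n : ℝ)⁻¹ * M * |∑ i, (if ε i then (1 : ℝ) else -1)|) := by
      gcongr with ε
      exact hsup ε
    _ ≤ (2 ^ n : ℝ)⁻¹ * (∑ ε : Fin n → Bool,
        (⨆ f : F, (n : ℝ)⁻¹ * ∑ i, (if ε i then (1 : ℝ) else -1) * (f : Z → ℝ) (z i)) +
          (n : ℝ)⁻¹ * M * (2 ^ n * Real.sqrt n)) := by
      rw [Finset.sum_add_distrib, ← Finset.mul_sum]
      gcongr
      exact sum_abs_sum_sign_le n
    _ = _ := by
      rw [mul_add, div_eq_mul_inv, ← hsqrt]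
      congr 1
      field_simp
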